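/- For every c > b, w^{(q)}(c;0) − q∫_b^c 𝕎(c−y) w^{(q)}(y;0) dy = (1 − α W^{(q)}(0)) { 𝕎(c) + q∫₀^b 𝕎(c−y) 𝕎^{(q)}(y) dy } − α∫₀^b W^{(q)′}(z) { 𝕎(c−z) + q∫₀^{b−z} 𝕎(c−z−y) 𝕎^{(q)}(y) dy } dz. -/

import Mathlib

open MeasureTheory Set Filter Topology

/-- The Laplace exponent of a spectrally negative Lévy process with triplet `(γ, σ, ν)`. -/
noncomputable def levyPsi (γ σ : ℝ) (ν : Measure ℝ) (l : ℝ) : ℝ :=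
  γ * l + σ ^ 2 / 2 * l ^ 2 +
    ∫ z in Set.Ioi (0 : ℝ),
      (Real.exp (-l * z) - 1 +
        l * z * Set.indicator (Set.Ioc (0 : ℝ) 1) (fun _ => (1 : ℝ)) z) ∂ν

/-- The right-inverse `Φ(q) = sup {λ ≥ 0 : f(λ) = q}` of a Laplace exponent `f`. -/
noncomputable def levyPhi (f : ℝ → ℝ) (q : ℝ) : ℝ :=
  sSup {l : ℝ | 0 ≤ l ∧ f l = q}

/-- `∫₀¹ z ν(dz)`, as an extended nonnegative real. -/
noncomputable def smallJumpMass (ν : Measure ℝ) : ENNReal :=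
  ∫⁻ z in Set.Ioc (0 : ℝ) 1, ENNReal.ofReal z ∂ν

/-- `ν` is a Lévy measure on `(0,∞)`: it charges only `(0,∞)` and
integrates `min(1, z²)`. -/
def IsLevyMeasure (ν : Measure ℝ) : Prop :=
  ν (Set.Iic 0) = 0 ∧ (∫⁻ z in Set.Ioi (0 : ℝ), ENNReal.ofReal (min 1 (z ^ 2)) ∂ν) ≠ ⊤

/-- The process is not the negative of a subordinator: `σ > 0`, or
`∫₀¹ z ν(dz) = ∞`, or `γ + ∫₀¹ z ν(dz) > 0`. -/
def NonDegenerate (γ σ : ℝ) (ν : Measure ℝ) : Prop :=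
  0 < σ ∨ smallJumpMass ν = ⊤ ∨ 0 < γ + (smallJumpMass ν).toReal

/-- `W` is the `q`-scale function associated with the Laplace exponent `f`,
where `Φq` is the value of the right-inverse of `f` at `q`. -/
def IsScaleFunction (f : ℝ → ℝ) (Φq q : ℝ) (W : ℝ → ℝ) : Prop :=
  (∀ x < 0, W x = 0) ∧ ContinuousOn W (Set.Ici 0) ∧ MonotoneOn W (Set.Ici 0) ∧
    ∀ l, Φq < l → (∫ y in Set.Ioi (0 : ℝ), Real.exp (-l * y) * W y) = 1 / (f l - q)

/-- Admissibility of the refraction parameter `α`: `α > 0`, and when the paths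
have bounded variation (`σ = 0` and `∫₀¹ z ν(dz) < ∞`), `α` is smaller than the
drift `c = γ + ∫₀¹ z ν(dz)`. -/
def AlphaAdmissible (γ σ α : ℝ) (ν : Measure ℝ) : Prop :=
  0 < α ∧ ((σ = 0 ∧ smallJumpMass ν ≠ ⊤) → α < γ + (smallJumpMass ν).toReal)

/-- The function `w^{(q)}(·;0)` associated with the refracted process:
`w^{(q)}(x;0) = W^{(q)}(x) + α·1_{{x ≥ b}}∫_b^x 𝕎^{(q)}(x-y) W^{(q)′}(y) dy`. -/
noncomputable def refractedW (α b : ℝ) (W W' Wαq : ℝ → ℝ) (x : ℝ) : ℝ :=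
  W x + α * (if b ≤ x then ∫ y in b..x, Wαq (x - y) * W' y else 0)

/-- The function `z^{(q)}(·;0)` associated with the refracted process:
`z^{(q)}(x;0) = Z^{(q)}(x) + αq·1_{{x ≥ b}}∫_b^x 𝕎^{(q)}(x-y) W^{(q)}(y) dy`,
where `Z^{(q)}(x) = 1 + q∫₀ˣ W^{(q)}(y) dy`. -/
noncomputable def refractedZ (α b q : ℝ) (W Wαq : ℝ → ℝ) (x : ℝ) : ℝ :=
  (1 + q * ∫ y in (0:ℝ)..x, W y) +
    α * q * (if b ≤ x then ∫ y in b..x, Wαq (x - y) * W y else 0)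


/-- A function whose exponential moments vanish in a neighbourhood of zero is almost everywhere
zero. -/
lemma ae_eq_zero_of_integral_exp_mul_eq_zero {μ : Measure ℝ} [SigmaFinite μ] {h : ℝ → ℝ} {δ : ℝ}
    (hδ : 0 < δ) (hfint : ∀ t ∈ Ioo (-δ) δ, Integrable (fun y => Real.exp (t * y) * h y) μ)
    (hzero : ∀ t ∈ Ioo (-δ) δ, ∫ y, Real.exp (t * y) * h y ∂μ = 0) : h =ᵐ[μ] 0 := by
  have h0 : Integrable h μ := by simpa using hfint 0 ⟨by linarith, hδ⟩
  have hmeas : AEMeasurable h μ := h0.aemeasurable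
  have key : ∀ k : ℝ → ℝ, AEMeasurable k μ → (∀ y, |k y| ≤ |h y|) →
      Ioo (-δ) δ ⊆ ProbabilityTheory.integrableExpSet id
        (μ.withDensity fun y => ENNReal.ofReal (k y)) := by
    intro k hk hkh t ht
    rw [ProbabilityTheory.integrableExpSet, mem_ofPred_eq,
      integrable_withDensity_iff_integrable_smul₀' hk.ennreal_ofReal (by simp)]
    refine (hfint t ht).mono (by fun_prop) (Eventually.of_forall fun y => ?_)
    simp only [smul_eq_mul, id, norm_mul, Real.norm_eq_abs, Real.abs_exp]
    rw [mul_comm]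
    refine mul_le_mul_of_nonneg_left ?_ (Real.exp_pos _).le
    refine le_trans ?_ (hkh y)
    rw [ENNReal.toReal_ofReal', abs_of_nonneg (le_max_right _ _)]
    exact max_le (le_abs_self _) (abs_nonneg _)
  set P := μ.withDensity fun y => ENNReal.ofReal (h y) with hP
  set N := μ.withDensity fun y => ENNReal.ofReal (-h y) with hN
  have hPs := key h hmeas fun _ => le_rfl
  have hNs := key (fun y => -h y) hmeas.neg fun _ => (abs_neg _).le
  have : IsFiniteMeasure P := isFiniteMeasure_withDensity_ofReal h0.2
  have : IsFiniteMeasure N := isFiniteMeasure_withDensity_ofReal h0.neg.2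
  have hmgf : ∀ t ∈ Ioo (-δ) δ, ProbabilityTheory.mgf id P t = ProbabilityTheory.mgf id N t := by
    intro t ht
    have i1 := hPs ht
    have i2 := hNs ht
    rw [ProbabilityTheory.integrableExpSet, mem_ofPred_eq,
      integrable_withDensity_iff_integrable_smul₀' (by fun_prop) (by simp)] at i1 i2
    rw [ProbabilityTheory.mgf, ProbabilityTheory.mgf, hP, hN,
      integral_withDensity_eq_integral_toReal_smul₀ (by fun_prop) (by simp),
      integral_withDensity_eq_integral_toReal_smul₀ (by fun_prop) (by simp), ← sub_eq_zero,
      ← integral_sub i1 i2, ← hzero t ht]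
    congr 1 with y
    simp only [smul_eq_mul, id, ENNReal.toReal_ofReal']
    rw [← sub_mul, mul_comm]
    congr 1
    rcases le_total 0 (h y) with hy | hy
    · rw [max_eq_left hy, max_eq_right (by linarith), sub_zero]
    · rw [max_eq_right hy, max_eq_left (by linarith)]; ring
  have hsub : ∀ {s : Set ℝ}, Ioo (-δ) δ ⊆ s → Ioo (-δ) δ ⊆ interior s :=
    fun hs => interior_maximal hs isOpen_Ioo
  have hEq : Set.EqOn (ProbabilityTheory.complexMGF id P) (ProbabilityTheory.complexMGF id N)
      {z | z.re ∈ Ioo (-δ) δ} := by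
    refine AnalyticOnNhd.eqOn_of_preconnected_of_frequently_eq
      (ProbabilityTheory.analyticOnNhd_complexMGF.mono fun z hz => hsub hPs hz)
      (ProbabilityTheory.analyticOnNhd_complexMGF.mono fun z hz => hsub hNs hz)
      ((convex_Ioo _ _).linear_preimage Complex.reLm).isPreconnected (z₀ := 0)
      (by simpa using hδ) ?_
    have hreal : ∃ᶠ x : ℝ in 𝓝[≠] 0,
        ProbabilityTheory.complexMGF id P x = ProbabilityTheory.complexMGF id N x := by
      refine Eventually.frequently ?_
      have : Ioo (-δ) δ ∈ 𝓝 (0 : ℝ) := Ioo_mem_nhds (by linarith) hδ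
      filter_upwards [mem_nhdsWithin_of_mem_nhds this] with y hy
      rw [ProbabilityTheory.complexMGF_ofReal, ProbabilityTheory.complexMGF_ofReal, hmgf y hy]
    have htend : Tendsto (fun x : ℝ => (x : ℂ)) (𝓝[≠] 0) (𝓝[≠] 0) := by
      refine tendsto_nhdsWithin_iff.2 ⟨?_, ?_⟩
      · exact (Complex.continuous_ofReal.tendsto' 0 0 (by simp)).mono_left nhdsWithin_le_nhds
      · filter_upwards [self_mem_nhdsWithin] with x hx
        simpa using hx
    exact htend.frequently hreal
  have hPN : P = N := by
    apply Measure.ext_of_charFun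
    ext t
    rw [← ProbabilityTheory.complexMGF_id_mul_I, ← ProbabilityTheory.complexMGF_id_mul_I]
    exact hEq (by simpa using hδ)
  rw [hP, hN, withDensity_eq_iff_of_sigmaFinite (by fun_prop) (by fun_prop)] at hPN
  filter_upwards [hPN] with y hy
  have := congrArg ENNReal.toReal hy
  simp only [ENNReal.toReal_ofReal'] at this
  rcases le_total 0 (h y) with hy | hy
  · rw [max_eq_left hy, max_eq_right (by linarith)] at this
    exact this
  · rw [max_eq_right hy, max_eq_left (by linarith)] at this
    simp only [Pi.zero_apply]; linarith

/-- Uniqueness of the Laplace transform. -/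
lemma ae_eq_of_laplace_eq {f g : ℝ → ℝ} {L : ℝ}
    (hf : ∀ l, L < l → IntegrableOn (fun y => Real.exp (-l * y) * f y) (Ioi 0))
    (hg : ∀ l, L < l → IntegrableOn (fun y => Real.exp (-l * y) * g y) (Ioi 0))
    (hfg : ∀ l, L < l → ∫ y in Ioi (0 : ℝ), Real.exp (-l * y) * f y =
      ∫ y in Ioi (0 : ℝ), Real.exp (-l * y) * g y) :
    f =ᵐ[volume.restrict (Ioi 0)] g := by
  have e : ∀ t y : ℝ, Real.exp (t * y) * (Real.exp (-(L + 1) * y) * (f y - g y)) =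
      Real.exp (-(L + 1 - t) * y) * f y - Real.exp (-(L + 1 - t) * y) * g y := by
    intro t y
    rw [← mul_assoc, ← Real.exp_add, ← mul_sub]
    ring_nf
  have := ae_eq_zero_of_integral_exp_mul_eq_zero (μ := volume.restrict (Ioi 0))
    (h := fun y => Real.exp (-(L + 1) * y) * (f y - g y)) one_pos ?_ ?_
  · filter_upwards [this] with y hy
    have := (mul_eq_zero.1 hy).resolve_left (Real.exp_pos _).ne'
    linarith
  · intro t ht
    simp only [e]
    exact (hf _ (by linarith [ht.2])).sub (hg _ (by linarith [ht.2]))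
  · intro t ht
    simp only [e]
    rw [integral_sub (hf _ (by linarith [ht.2])) (hg _ (by linarith [ht.2])),
      hfg _ (by linarith [ht.2]), sub_self]

/-- Truncating the small jumps at a suitable level leaves a drift which exceeds `α`. -/
lemma exists_truncated_drift_gt {γ α : ℝ} {ν : Measure ℝ}
    (h : smallJumpMass ν ≠ ⊤ → α < γ + (smallJumpMass ν).toReal) :
    ∃ ε : ℝ, 0 < ε ∧ ε ≤ 1 ∧
      (γ ≤ α → ENNReal.ofReal (α - γ) < ∫⁻ z in Ioc ε 1, ENNReal.ofReal z ∂ν) := by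
  rcases lt_or_ge α γ with hlt | hge
  · exact ⟨1, one_pos, le_rfl, fun h => absurd hlt h.not_gt⟩
  have hmass : ENNReal.ofReal (α - γ) < smallJumpMass ν := by
    by_cases ht : smallJumpMass ν = ⊤
    · simp [ht]
    · exact (ENNReal.ofReal_lt_iff_lt_toReal (by linarith) ht).2 (by linarith [h ht])
  have hU : (⋃ n : ℕ, Ioc (1 / ((n : ℝ) + 1)) 1) = Ioc (0 : ℝ) 1 := by
    ext z
    simp only [mem_iUnion, mem_Ioc]
    constructor
    · rintro ⟨n, hn, h1⟩
      exact ⟨lt_trans (by positivity) hn, h1⟩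
    · rintro ⟨h0, h1⟩
      obtain ⟨n, hn⟩ := exists_nat_one_div_lt h0
      exact ⟨n, hn, h1⟩
  have hmono : Monotone fun n : ℕ => Ioc (1 / ((n : ℝ) + 1)) 1 := by
    intro m n hmn
    refine Ioc_subset_Ioc_left ?_
    gcongr
  rw [smallJumpMass, ← hU, setLIntegral_iUnion_of_directed _ hmono.directed_le, lt_iSup_iff]
    at hmass
  obtain ⟨n, hn⟩ := hmass
  refine ⟨1 / ((n : ℝ) + 1), by positivity, ?_, fun _ => hn⟩
  rw [div_le_one (by positivity)]
  linarith [(Nat.cast_nonneg n : (0 : ℝ) ≤ n)]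

/-- The compensated jump integrand is dominated by a multiple of `min 1 (z ^ 2)`. -/
lemma abs_levy_integrand_le {l z : ℝ} (hl : 0 ≤ l) (hz : 0 < z) :
    |Real.exp (-l * z) - 1 + l * z * Set.indicator (Ioc (0 : ℝ) 1) (fun _ => (1 : ℝ)) z| ≤
      (1 + l ^ 2) * min 1 (z ^ 2) := by
  have hlz : 0 ≤ l * z := by positivity
  have h1 : Real.exp (-l * z) ≤ 1 := Real.exp_le_one_iff.2 (by linarith)
  rcases le_or_gt z 1 with h | h
  · rw [indicator_of_mem (show z ∈ Ioc (0 : ℝ) 1 from ⟨hz, h⟩), min_eq_right (by nlinarith)]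
    have h2 := Real.add_one_le_exp (-l * z)
    rw [abs_of_nonneg (by linarith)]
    have h3 : Real.exp (-l * z) ≤ 1 / (1 + l * z) := by
      rw [neg_mul, Real.exp_neg, ← one_div]
      exact one_div_le_one_div_of_le (by positivity) (by linarith [Real.add_one_le_exp (l * z)])
    have h4 : 1 / (1 + l * z) - 1 + l * z ≤ (l * z) ^ 2 := by
      have : 1 / (1 + l * z) - 1 + l * z = (l * z) ^ 2 / (1 + l * z) := by field_simp; ring
      rw [this]
      exact div_le_self (by positivity) (by linarith)
    nlinarith [sq_nonneg z]
  · rw [indicator_of_notMem (fun hm : z ∈ Ioc (0 : ℝ) 1 => by linarith [hm.2]),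
      min_eq_left (by nlinarith), abs_of_nonpos (by linarith)]
    nlinarith [Real.exp_pos (-l * z), sq_nonneg l]

lemma integrableOn_levy_integrand {ν : Measure ℝ} (hν : IsLevyMeasure ν) {l : ℝ} (hl : 0 ≤ l) :
    IntegrableOn (fun z => Real.exp (-l * z) - 1 +
      l * z * Set.indicator (Ioc (0 : ℝ) 1) (fun _ => (1 : ℝ)) z) (Ioi 0) ν := by
  have hmin : IntegrableOn (fun z : ℝ => min 1 (z ^ 2)) (Ioi 0) ν := by
    refine ⟨by fun_prop, ?_⟩
    rw [hasFiniteIntegral_iff_ofReal (Eventually.of_forall fun z => by positivity)]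
    exact lt_top_iff_ne_top.2 hν.2
  refine (hmin.const_mul (1 + l ^ 2)).mono' ?_ ?_
  · have : Measurable fun z : ℝ => Set.indicator (Ioc (0 : ℝ) 1) (fun _ => (1 : ℝ)) z :=
      measurable_const.indicator measurableSet_Ioc
    fun_prop
  · filter_upwards [ae_restrict_mem measurableSet_Ioi] with z hz
    exact abs_levy_integrand_le hl hz

lemma levy_measure_Ioi_lt_top {ν : Measure ℝ} (hν : IsLevyMeasure ν) {ε : ℝ} (hε : 0 < ε)
    (hε1 : ε ≤ 1) : ν (Ioi ε) < ⊤ := by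
  have h : ENNReal.ofReal (ε ^ 2) * ν (Ioi ε) ≤
      ∫⁻ z in Ioi (0 : ℝ), ENNReal.ofReal (min 1 (z ^ 2)) ∂ν := by
    rw [← setLIntegral_const]
    refine (setLIntegral_mono' measurableSet_Ioi fun z (hz : ε < z) => ?_).trans
      (lintegral_mono_set (Ioi_subset_Ioi hε.le))
    exact ENNReal.ofReal_le_ofReal (le_min (by nlinarith) (by nlinarith))
  by_contra htop
  rw [not_lt, top_le_iff] at htop
  rw [htop, ENNReal.mul_top (by simpa using by positivity), top_le_iff] at h
  exact hν.2 h

/-- The Laplace exponent of the refracted process is eventually larger than any given level. -/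
lemma eventually_lt_levyPsi_sub {γ σ α : ℝ} (hσ : 0 ≤ σ) {ν : Measure ℝ}
    (hν : IsLevyMeasure ν) (hα : AlphaAdmissible γ σ α ν) (q : ℝ) :
    ∀ᶠ l in atTop, q < levyPsi γ σ ν l - α * l := by
  have lower : ∀ ε : ℝ, 0 < ε → ε ≤ 1 → ∃ m : ℝ,
      ENNReal.ofReal m = ∫⁻ z in Ioc ε 1, ENNReal.ofReal z ∂ν ∧ 0 ≤ m ∧ ∀ l, 0 ≤ l →
      γ * l + σ ^ 2 / 2 * l ^ 2 + (l * m - (ν (Ioi ε)).toReal) ≤ levyPsi γ σ ν l := by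
    intro ε hε hε1
    have hfin := levy_measure_Ioi_lt_top hν hε hε1
    have hi1 : IntegrableOn (fun z : ℝ => z) (Ioc ε 1) ν := by
      refine Measure.integrableOn_of_bounded (M := 1)
        (ne_top_of_le_ne_top hfin.ne (measure_mono Ioc_subset_Ioi_self)) (by fun_prop) ?_
      filter_upwards [ae_restrict_mem measurableSet_Ioc] with z hz
      rw [Real.norm_of_nonneg (by linarith [hz.1])]
      exact hz.2
    have hi2 : IntegrableOn (fun _ : ℝ => (1 : ℝ)) (Ioi ε) ν :=
      integrableOn_const hfin.ne
    have hnn : 0 ≤ᵐ[ν.restrict (Ioc ε 1)] fun z : ℝ => z := by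
      filter_upwards [ae_restrict_mem measurableSet_Ioc] with z hz
      exact (hε.trans hz.1).le
    refine ⟨∫ z in Ioc ε 1, z ∂ν, ofReal_integral_eq_lintegral_ofReal hi1 hnn,
      integral_nonneg_of_ae hnn, fun l hl => ?_⟩
    rw [levyPsi]
    gcongr
    have hs1 : Ioi (0 : ℝ) ∩ Ioc ε 1 = Ioc ε 1 :=
      inter_eq_right.2 fun z hz => hε.trans hz.1
    have hs2 : Ioi (0 : ℝ) ∩ Ioi ε = Ioi ε :=
      inter_eq_right.2 fun z hz => hε.trans hz
    have j1 : IntegrableOn (fun z => l * (Ioc ε 1).indicator (fun z => z) z) (Ioi 0) ν :=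
      ((integrable_indicator_iff measurableSet_Ioc).2 hi1).integrableOn.const_mul l
    have j2 : IntegrableOn ((Ioi ε).indicator fun _ : ℝ => (1 : ℝ)) (Ioi 0) ν :=
      ((integrable_indicator_iff measurableSet_Ioi).2 hi2).integrableOn
    have : l * (∫ z in Ioc ε 1, z ∂ν) - (ν (Ioi ε)).toReal =
        ∫ z in Ioi (0 : ℝ), (l * (Ioc ε 1).indicator (fun z => z) z -
          (Ioi ε).indicator (fun _ => (1 : ℝ)) z) ∂ν := by
      rw [integral_sub j1 j2, integral_const_mul, setIntegral_indicator measurableSet_Ioc,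
        setIntegral_indicator measurableSet_Ioi, hs1, hs2]
      simp [Measure.real]
    rw [this]
    refine setIntegral_mono_on (j1.sub j2) (integrableOn_levy_integrand hν hl)
      measurableSet_Ioi fun z (hz : 0 < z) => ?_
    have e1 := Real.add_one_le_exp (-l * z)
    have e2 := Real.exp_pos (-l * z)
    rw [neg_mul] at e1 e2
    by_cases h1 : ε < z <;> by_cases h2 : z ≤ 1 <;>
      simp [indicator, h1, h2, hz] <;> linarith
  rcases hσ.eq_or_lt with h0 | hpos
  · obtain ⟨ε, hε, hε1, h2⟩ := exists_truncated_drift_gt (fun h => hα.2 ⟨h0.symm, h⟩)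
    obtain ⟨m, hm, hm0, hl⟩ := lower ε hε hε1
    have hδ : 0 < γ + m - α := by
      rcases lt_or_ge α γ with hlt | hge
      · linarith
      · have := h2 hge
        rw [← hm] at this
        linarith [(ENNReal.ofReal_lt_ofReal_iff_of_nonneg (by linarith)).1 this]
    have ht : Tendsto (fun l : ℝ => (γ + m - α) * l) atTop atTop :=
      tendsto_id.const_mul_atTop hδ
    filter_upwards [ht.eventually_gt_atTop (q + (ν (Ioi ε)).toReal), eventually_ge_atTop 0]
      with l hl1 hl2
    have := hl l hl2
    rw [← h0] at this ⊢
    linarith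
  · obtain ⟨m, -, hm0, hl⟩ := lower 1 one_pos le_rfl
    have ht : Tendsto (fun l : ℝ => l * (σ ^ 2 / 2 * l + (γ - α))) atTop atTop :=
      tendsto_id.atTop_mul_atTop₀ (tendsto_atTop_add_const_right _ _
        (tendsto_id.const_mul_atTop (by positivity)))
    filter_upwards [ht.eventually_gt_atTop (q + (ν (Ioi 1)).toReal), eventually_ge_atTop 0]
      with l hl1 hl2
    nlinarith [hl l hl2, mul_nonneg hl2 hm0]

/-- Finite convolutions of a continuous function with a locally integrable one are continuous. -/
lemma continuousOn_convolution_Ioi {f g : ℝ → ℝ} (hg : ContinuousOn g (Ici 0))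
    (hf : ∀ X, IntegrableOn f (Ioc 0 X)) :
    ContinuousOn (fun x => ∫ t in (0 : ℝ)..x, g (x - t) * f t) (Ioi 0) := by
  intro x₀ hx₀
  have hx₀' : (0 : ℝ) < x₀ := hx₀
  refine ContinuousAt.continuousWithinAt ?_
  set G : ℝ → ℝ := fun y => g (max y 0) with hG
  have hGc : Continuous G :=
    hg.comp_continuous (by fun_prop) fun y => le_max_right y 0
  obtain ⟨C, hC⟩ := isCompact_Icc.exists_bound_of_continuousOn (s := Icc 0 (x₀ + 1))
    (hg.mono Icc_subset_Ici_self)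
  have hC' : ∀ y, y ≤ x₀ + 1 → ‖G y‖ ≤ C := fun y hy =>
    hC _ ⟨le_max_right _ _, max_le hy (by linarith)⟩
  have heq : (fun x => ∫ t in (0 : ℝ)..x, g (x - t) * f t) =ᶠ[𝓝 x₀]
      fun x => ∫ t in Ioc 0 (x₀ + 1), (Ioc 0 x).indicator (fun t => G (x - t) * f t) t := by
    filter_upwards [Ioo_mem_nhds hx₀' (lt_add_one x₀)] with x hx
    rw [intervalIntegral.integral_of_le hx.1.le, setIntegral_indicator measurableSet_Ioc,
      inter_eq_right.2 (Ioc_subset_Ioc_right hx.2.le)]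
    refine setIntegral_congr_fun measurableSet_Ioc fun t ht => ?_
    simp only [hG, max_eq_left (sub_nonneg.2 ht.2)]
  refine ContinuousAt.congr ?_ heq.symm
  refine continuousAt_of_dominated (bound := fun t => C * ‖f t‖) ?_ ?_
    ((hf _).norm.const_mul C) ?_
  · refine Eventually.of_forall fun x => ?_
    refine AEStronglyMeasurable.indicator ?_ measurableSet_Ioc
    exact (hGc.comp (continuous_const.sub continuous_id)).aestronglyMeasurable.mul
      (hf _).aestronglyMeasurable
  · filter_upwards [Ioo_mem_nhds hx₀' (lt_add_one x₀)] with x hx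
    filter_upwards [ae_restrict_mem measurableSet_Ioc] with t ht
    refine (norm_indicator_le_norm_self _ _).trans ?_
    rw [norm_mul]
    exact mul_le_mul_of_nonneg_right (hC' _ (by linarith [ht.1, hx.2])) (norm_nonneg _)
  · have hne : ∀ᵐ t ∂volume.restrict (Ioc 0 (x₀ + 1)), t ≠ x₀ :=
      ae_restrict_of_ae (Measure.ae_ne volume x₀)
    filter_upwards [hne, ae_restrict_mem measurableSet_Ioc] with t ht ht0
    rcases lt_or_gt_of_ne ht with hlt | hgt
    · refine ContinuousAt.congr (f := fun x => G (x - t) * f t) (by fun_prop) ?_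
      filter_upwards [lt_mem_nhds hlt] with x hx
      exact (indicator_of_mem (s := Ioc 0 x) ⟨ht0.1, hx.le⟩ fun t => G (x - t) * f t).symm
    · refine ContinuousAt.congr (f := fun _ => (0 : ℝ)) (by fun_prop) ?_
      filter_upwards [gt_mem_nhds hgt] with x hx
      exact (indicator_of_notMem (s := Ioc 0 x) (fun h => not_lt.2 h.2 hx)
        fun t => G (x - t) * f t).symm

/-- The Laplace transform turns finite convolutions into products. -/
lemma laplace_convolution {f g : ℝ → ℝ} {l : ℝ}
    (hf : IntegrableOn (fun y => Real.exp (-l * y) * f y) (Ioi 0))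
    (hg : IntegrableOn (fun y => Real.exp (-l * y) * g y) (Ioi 0)) :
    IntegrableOn (fun x => Real.exp (-l * x) * ∫ t in (0 : ℝ)..x, g (x - t) * f t) (Ioi 0) ∧
      ∫ x in Ioi (0 : ℝ), Real.exp (-l * x) * ∫ t in (0 : ℝ)..x, g (x - t) * f t =
        (∫ y in Ioi (0 : ℝ), Real.exp (-l * y) * g y) *
          ∫ y in Ioi (0 : ℝ), Real.exp (-l * y) * f y := by
  have e : ∀ x : ℝ, (∫ t in (0 : ℝ)..x, ContinuousLinearMap.mul ℝ ℝ
      (Real.exp (-l * t) * f t) (Real.exp (-l * (x - t)) * g (x - t))) =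
      Real.exp (-l * x) * ∫ t in (0 : ℝ)..x, g (x - t) * f t := by
    intro x
    rw [← intervalIntegral.integral_const_mul]
    congr 1 with t
    have : Real.exp (-l * x) = Real.exp (-l * t) * Real.exp (-l * (x - t)) := by
      rw [← Real.exp_add]; ring_nf
    rw [this, ContinuousLinearMap.mul_apply']
    ring
  have h1 := integrable_posConvolution hf hg (ContinuousLinearMap.mul ℝ ℝ)
  have h2 := integral_posConvolution hf hg (ContinuousLinearMap.mul ℝ ℝ)
  rw [posConvolution, integrable_indicator_iff measurableSet_Ioi] at h1
  simp only [e] at h1 h2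
  refine ⟨h1, h2.trans ?_⟩
  rw [ContinuousLinearMap.mul_apply', mul_comm]

/-- A monotone function with finite Laplace transform on `(L, ∞)` is `o(e^{ly})` for `l > L`. -/
lemma tendsto_exp_mul_of_monotoneOn {W : ℝ → ℝ} {L : ℝ} (hL : 0 ≤ L)
    (hmono : MonotoneOn W (Ici 0))
    (hfint : ∀ l, L < l → IntegrableOn (fun y => Real.exp (-l * y) * W y) (Ioi 0))
    {l : ℝ} (hl : L < l) : Tendsto (fun y => Real.exp (-l * y) * W y) atTop (𝓝 0) := by
  obtain ⟨m, hLm, hml⟩ := exists_between hl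
  have hm0 : 0 < m := hL.trans_lt hLm
  have hexp : ∀ c : ℝ, 0 < c → Tendsto (fun y : ℝ => Real.exp (-c * y)) atTop (𝓝 0) := by
    intro c hc
    refine Real.tendsto_exp_atBot.comp ?_
    exact tendsto_id.const_mul_atTop_of_neg (neg_lt_zero.2 hc)
  have hconst : IntegrableOn (fun y => Real.exp (-m * y) * W 0) (Ioi 0) :=
    (integrableOn_exp_mul_Ioi (by linarith) 0).mul_const _
  have hi : IntegrableOn (fun y => Real.exp (-m * y) * (W y - W 0)) (Ioi 0) := by
    simp only [mul_sub]
    exact (hfint m hLm).sub hconst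
  set C := ∫ y in Ioi (0 : ℝ), Real.exp (-m * y) * (W y - W 0) with hC
  have hW0 : ∀ y, 0 ≤ y → 0 ≤ W y - W 0 := fun y hy =>
    sub_nonneg.2 (hmono self_mem_Ici hy hy)
  have hbound : ∀ x, 0 ≤ x → Real.exp (-m * x) * (W x - W 0) ≤ C * Real.exp m := by
    intro x hx
    have h1 : ∫ _ in Ioc x (x + 1), Real.exp (-m * (x + 1)) * (W x - W 0) ≤
        ∫ y in Ioc x (x + 1), Real.exp (-m * y) * (W y - W 0) := by
      refine setIntegral_mono_on (integrableOn_const measure_Ioc_lt_top.ne)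
        (hi.mono_set fun y hy => hx.trans_lt hy.1)
        measurableSet_Ioc fun y hy => ?_
      refine mul_le_mul (Real.exp_le_exp.2 (by nlinarith [hy.2])) ?_ (hW0 x hx)
        (Real.exp_pos _).le
      exact sub_le_sub_right (hmono hx (hx.trans hy.1.le) hy.1.le) _
    have h2 : ∫ y in Ioc x (x + 1), Real.exp (-m * y) * (W y - W 0) ≤ C := by
      refine setIntegral_mono_set hi ?_ (LE.le.eventuallyLE fun y hy =>
        hx.trans_lt hy.1)
      filter_upwards [ae_restrict_mem measurableSet_Ioi] with y hy
      exact mul_nonneg (Real.exp_pos _).le (hW0 y (mem_Ioi.1 hy).le)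
    rw [setIntegral_const] at h1
    simp only [measureReal_def, Real.volume_Ioc, add_sub_cancel_left, ENNReal.ofReal_one,
      ENNReal.toReal_one, one_smul] at h1
    have h3 : Real.exp (-m * x) = Real.exp (-m * (x + 1)) * Real.exp m := by
      rw [← Real.exp_add]; ring_nf
    rw [h3, mul_right_comm]
    exact mul_le_mul_of_nonneg_right (h1.trans h2) (Real.exp_pos _).le
  have hz : Tendsto (fun y => Real.exp (-l * y) * (W y - W 0)) atTop (𝓝 0) := by
    have hlim : Tendsto (fun y => Real.exp (-(l - m) * y) * (C * Real.exp m)) atTop (𝓝 0) := by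
      simpa using (hexp (l - m) (by linarith)).mul_const (C * Real.exp m)
    refine squeeze_zero' ?_ ?_ hlim
    · filter_upwards [eventually_ge_atTop 0] with y hy
      exact mul_nonneg (Real.exp_pos _).le (hW0 y hy)
    · filter_upwards [eventually_ge_atTop 0] with y hy
      have : Real.exp (-l * y) = Real.exp (-(l - m) * y) * Real.exp (-m * y) := by
        rw [← Real.exp_add]; ring_nf
      rw [this, mul_assoc]
      exact mul_le_mul_of_nonneg_left (hbound y hy) (Real.exp_pos _).le
  have := hz.add ((hexp l (hm0.trans hml)).mul_const (W 0))
  simpa [mul_sub] using this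

/-- The Laplace transform of the derivative of a monotone function. -/
lemma laplace_deriv_of_monotoneOn {W W' : ℝ → ℝ} {L : ℝ} (hL : 0 ≤ L)
    (hcont : ContinuousOn W (Ici 0)) (hmono : MonotoneOn W (Ici 0))
    (hderiv : ∀ y, 0 < y → HasDerivAt W (W' y) y)
    (hfint : ∀ l, L < l → IntegrableOn (fun y => Real.exp (-l * y) * W y) (Ioi 0))
    {l : ℝ} (hl : L < l) :
    IntegrableOn (fun y => Real.exp (-l * y) * W' y) (Ioi 0) ∧
      ∫ y in Ioi (0 : ℝ), Real.exp (-l * y) * W' y =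
        l * (∫ y in Ioi (0 : ℝ), Real.exp (-l * y) * W y) - W 0 := by
  have hpos : ∀ y, 0 < y → 0 ≤ W' y := by
    intro y hy
    have hd := (hderiv y hy).deriv
    rw [← hd, ← derivWithin_of_mem_nhds (Ici_mem_nhds hy)]
    exact hmono.derivWithin_nonneg
  have hec : ContinuousOn (fun y => Real.exp (-l * y) * W y) (Ici 0) := by fun_prop
  set H : ℝ → ℝ := fun y =>
    Real.exp (-l * y) * W y + l * ∫ t in (0 : ℝ)..y, Real.exp (-l * t) * W t with hH
  have hii : ∀ y, 0 ≤ y → IntervalIntegrable (fun y => Real.exp (-l * y) * W y) volume 0 y :=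
    fun y hy => (hec.mono (by rw [uIcc_of_le hy]; exact Icc_subset_Ici_self)).intervalIntegrable
  have hHd : ∀ y ∈ Ioi (0 : ℝ), HasDerivAt H (Real.exp (-l * y) * W' y) y := by
    intro y hy
    have hy0 : (0 : ℝ) < y := hy
    have d1 : HasDerivAt (fun y => Real.exp (-l * y)) (Real.exp (-l * y) * (-l * 1)) y :=
      ((hasDerivAt_id y).const_mul (-l)).exp
    have d2 := d1.mul (hderiv y hy)
    have hca : ∀ᶠ z in 𝓝 y, ContinuousAt (fun y => Real.exp (-l * y) * W y) z := by
      filter_upwards [lt_mem_nhds hy0] with z hz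
      exact hec.continuousAt (Ici_mem_nhds hz)
    have d3 := intervalIntegral.integral_hasDerivAt_right (hii y hy0.le)
      ((hec.mono Ioi_subset_Ici_self).stronglyMeasurableAtFilter isOpen_Ioi y hy)
      hca.self_of_nhds
    refine (d2.add (d3.const_mul l)).congr_deriv ?_
    ring
  have hHc : ContinuousWithinAt H (Ici 0) 0 := by
    refine (hec 0 self_mem_Ici).add (ContinuousWithinAt.const_mul ?_ l)
    have h1 : IntegrableOn (fun t => Real.exp (-l * t) * W t) (uIcc 0 1) :=
      (hec.mono (by rw [uIcc_of_le zero_le_one]; exact Icc_subset_Ici_self)).integrableOn_compact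
        isCompact_uIcc
    have h2 := intervalIntegral.continuousOn_primitive_interval h1
    rw [uIcc_of_le zero_le_one] at h2
    exact (h2 0 (by simp)).mono_of_mem_nhdsWithin (Icc_mem_nhdsGE one_pos)
  have hHt : Tendsto H atTop (𝓝 (0 + l * ∫ y in Ioi (0 : ℝ), Real.exp (-l * y) * W y)) :=
    (tendsto_exp_mul_of_monotoneOn hL hmono hfint hl).add
      ((intervalIntegral_tendsto_integral_Ioi 0 (hfint l hl) tendsto_id).const_mul l)
  have hHp : ∀ y ∈ Ioi (0 : ℝ), 0 ≤ Real.exp (-l * y) * W' y := fun y hy =>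
    mul_nonneg (Real.exp_pos _).le (hpos y hy)
  refine ⟨integrableOn_Ioi_deriv_of_nonneg hHc hHd hHp hHt, ?_⟩
  rw [integral_Ioi_of_hasDerivAt_of_nonneg hHc hHd hHp hHt]
  simp [hH]

lemma integrableOn_Ioc_of_laplace {f : ℝ → ℝ} {l : ℝ}
    (hf : IntegrableOn (fun y => Real.exp (-l * y) * f y) (Ioi 0)) (X : ℝ) :
    IntegrableOn f (Ioc 0 X) := by
  have h1 : IntegrableOn (fun y => Real.exp (-l * y) * f y) (Icc 0 X) :=
    (integrableOn_Icc_iff_integrableOn_Ioc).2 (hf.mono_set Ioc_subset_Ioi_self)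
  have h2 := h1.continuousOn_mul (g := fun y => Real.exp (l * y)) (by fun_prop) isCompact_Icc
  refine IntegrableOn.mono_set ?_ Ioc_subset_Icc_self
  refine h2.congr_fun (fun y _ => ?_) measurableSet_Icc
  change Real.exp (l * y) * (Real.exp (-l * y) * f y) = f y
  rw [← mul_assoc, ← Real.exp_add]
  simp

lemma eqOn_Ioi_of_ae_eq {f g : ℝ → ℝ} (h : f =ᵐ[volume.restrict (Ioi 0)] g)
    (hf : ContinuousOn f (Ioi 0)) (hg : ContinuousOn g (Ioi 0)) : EqOn f g (Ioi 0) :=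
  Measure.eqOn_open_of_ae_eq h isOpen_Ioi hf hg

lemma IsScaleFunction.exists_laplace {f : ℝ → ℝ} {Φq q : ℝ} {W : ℝ → ℝ}
    (hW : IsScaleFunction f Φq q W) (hf : ∀ᶠ l in atTop, q < f l) :
    ∃ L, ∀ l, L < l → q < f l ∧
      IntegrableOn (fun y => Real.exp (-l * y) * W y) (Ioi 0) ∧
      ∫ y in Ioi (0 : ℝ), Real.exp (-l * y) * W y = 1 / (f l - q) := by
  obtain ⟨L, hL⟩ := eventually_atTop.1 hf
  refine ⟨max L Φq, fun l hl => ?_⟩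
  have h1 := hL l ((le_max_left _ _).trans hl.le)
  have h2 := hW.2.2.2 l ((le_max_right _ _).trans_lt hl)
  refine ⟨h1, Integrable.of_integral_ne_zero ?_, h2⟩
  rw [h2]
  exact one_div_ne_zero (sub_pos.2 h1).ne'

lemma intervalIntegrable_convolution_integrand {f g : ℝ → ℝ} (hg : ContinuousOn g (Ici 0))
    {u v x : ℝ} (hu : 0 ≤ u) (hv : 0 ≤ v) (hux : u ≤ x) (hvx : v ≤ x)
    (hf : IntegrableOn f (Ioc 0 x)) :
    IntervalIntegrable (fun t => g (x - t) * f t) volume u v := by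
  have hx : 0 ≤ x := hu.trans hux
  have h : IntervalIntegrable (fun t => g (x - t) * f t) volume 0 x := by
    rw [intervalIntegrable_iff_integrableOn_Icc_of_le hx]
    refine IntegrableOn.continuousOn_mul ?_ ((integrableOn_Icc_iff_integrableOn_Ioc).2 hf)
      isCompact_Icc
    exact hg.comp (by fun_prop) fun t ht => sub_nonneg.2 ht.2
  refine h.mono_set ?_
  rw [uIcc_of_le hx]
  exact uIcc_subset_Icc ⟨hu, hux⟩ ⟨hv, hvx⟩

/-- A resolvent equation for `V` and a convolution equation for `W` combine, by splitting the
convolutions at `b` and exchanging integrals. -/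
lemma refractedW_sub_integral_eq {α b c q k : ℝ} {W h U V : ℝ → ℝ} (hb : 0 < b) (hbc : b < c)
    (hU : ContinuousOn U (Ici 0)) (hV : ContinuousOn V (Ici 0))
    (hh : ∀ X, IntegrableOn h (Ioc 0 X))
    (hVU : ∀ x, 0 < x → V x = U x + q * ∫ y in (0 : ℝ)..x, U (x - y) * V y)
    (hWV : ∀ x, 0 < x → k * V x = W x + α * ∫ y in (0 : ℝ)..x, V (x - y) * h y) :
    refractedW α b W h V c - q * ∫ y in b..c, U (c - y) * refractedW α b W h V y =
      k * (U c + q * ∫ y in (0 : ℝ)..b, U (c - y) * V y) -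
        α * ∫ z in (0 : ℝ)..b, h z *
          (U (c - z) + q * ∫ y in (0 : ℝ)..(b - z), U (c - z - y) * V y) := by
  have hVint : ∀ X, IntegrableOn V (Ioc 0 X) := fun X =>
    ((hV.mono Icc_subset_Ici_self).integrableOn_compact (isCompact_Icc (a := 0) (b := X))).mono_set
      Ioc_subset_Icc_self
  have hw : ∀ y, b ≤ y →
      refractedW α b W h V y = k * V y - α * ∫ z in (0 : ℝ)..b, V (y - z) * h z := by
    intro y hy
    have hy0 : 0 < y := hb.trans_le hy
    rw [refractedW, if_pos hy, hWV y hy0, ← intervalIntegral.integral_add_adjacent_intervals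
      (intervalIntegrable_convolution_integrand hV le_rfl hb.le hy0.le hy (hh y))
      (intervalIntegrable_convolution_integrand hV hb.le hy0.le hy le_rfl (hh y))]
    ring
  have hsplit : ∀ x a, 0 < x → 0 ≤ a → a ≤ x → V x - q * ∫ y in a..x, U (x - y) * V y =
      U x + q * ∫ y in (0 : ℝ)..a, U (x - y) * V y := by
    intro x a hx ha hax
    rw [hVU x hx, ← intervalIntegral.integral_add_adjacent_intervals
      (intervalIntegrable_convolution_integrand hU le_rfl ha hx.le hax (hVint x))
      (intervalIntegrable_convolution_integrand hU ha hx.le hax le_rfl (hVint x))]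
    ring
  have hc : 0 < c := hb.trans hbc
  have hF : Integrable (Function.uncurry fun y z => U (c - y) * (V (y - z) * h z))
      ((volume.restrict (Ioc b c)).prod (volume.restrict (Ioc 0 b))) := by
    have h1 : IntegrableOn (fun p : ℝ × ℝ => h p.2) (Icc b c ×ˢ Icc 0 b)
        (volume.prod volume) := by
      rw [IntegrableOn, ← Measure.prod_restrict]
      exact Integrable.comp_snd ((integrableOn_Icc_iff_integrableOn_Ioc).2 (hh b)) _
    have h2 : ContinuousOn (fun p : ℝ × ℝ => U (c - p.1) * V (p.1 - p.2))
        (Icc b c ×ˢ Icc 0 b) :=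
      (hU.comp (by fun_prop) fun p hp => sub_nonneg.2 hp.1.2).mul
        (hV.comp (by fun_prop) fun p hp => sub_nonneg.2 (hp.2.2.trans hp.1.1))
    have h3 := (h1.continuousOn_mul h2 (isCompact_Icc.prod isCompact_Icc)).mono_set
      (prod_mono Ioc_subset_Icc_self Ioc_subset_Icc_self : Ioc b c ×ˢ Ioc 0 b ⊆ _)
    rw [IntegrableOn, ← Measure.prod_restrict] at h3
    refine h3.congr (Eventually.of_forall fun p => ?_)
    simp only [Function.uncurry]
    ring
  have hswap : (∫ y in b..c, U (c - y) * ∫ z in (0 : ℝ)..b, V (y - z) * h z) =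
      ∫ z in (0 : ℝ)..b, h z * ∫ y in (b - z)..(c - z), U (c - z - y) * V y := by
    have hin : ∀ z, (∫ y in (b - z)..(c - z), U (c - z - y) * V y) =
        ∫ y in b..c, U (c - y) * V (y - z) := by
      intro z
      rw [← intervalIntegral.integral_comp_sub_right (fun u => U (c - z - u) * V u) z]
      congr 1 with y
      ring_nf
    simp only [hin, ← intervalIntegral.integral_const_mul]
    rw [intervalIntegral.integral_of_le hbc.le, intervalIntegral.integral_of_le hb.le]
    simp only [intervalIntegral.integral_of_le hbc.le, intervalIntegral.integral_of_le hb.le]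
    rw [integral_integral_swap hF]
    congr 1 with z
    congr 1 with y
    ring
  have hout : IntervalIntegrable (fun y => U (c - y) * ∫ z in (0 : ℝ)..b, V (y - z) * h z)
      volume b c := by
    rw [intervalIntegrable_iff_integrableOn_Ioc_of_le hbc.le]
    refine hF.integral_prod_left.congr (Eventually.of_forall fun y => ?_)
    simp only [Function.uncurry]
    rw [integral_const_mul, intervalIntegral.integral_of_le hb.le]
  have hin : IntervalIntegrable
      (fun z => h z * ∫ y in (b - z)..(c - z), U (c - z - y) * V y) volume 0 b := by
    rw [intervalIntegrable_iff_integrableOn_Ioc_of_le hb.le]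
    refine hF.integral_prod_right.congr (Eventually.of_forall fun z => ?_)
    simp only [Function.uncurry]
    rw [← intervalIntegral.integral_of_le hbc.le, ← intervalIntegral.integral_const_mul,
      ← intervalIntegral.integral_comp_sub_right (fun u => h z * (U (c - z - u) * V u)) z]
    congr 1 with y
    ring_nf
  have hL : (∫ y in b..c, U (c - y) * refractedW α b W h V y) =
      k * (∫ y in b..c, U (c - y) * V y) -
        α * ∫ z in (0 : ℝ)..b, h z * ∫ y in (b - z)..(c - z), U (c - z - y) * V y := by
    rw [← hswap, ← intervalIntegral.integral_const_mul, ← intervalIntegral.integral_const_mul,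
      ← intervalIntegral.integral_sub
        ((intervalIntegrable_convolution_integrand hU hb.le hc.le hbc.le le_rfl
          (hVint c)).const_mul k) (hout.const_mul α)]
    refine intervalIntegral.integral_congr fun y hy => ?_
    rw [uIcc_of_le hbc.le] at hy
    simp only [hw y hy.1]
    ring
  have hR : (∫ z in (0 : ℝ)..b, h z *
      (U (c - z) + q * ∫ y in (0 : ℝ)..(b - z), U (c - z - y) * V y)) =
      (∫ z in (0 : ℝ)..b, V (c - z) * h z) -
        q * ∫ z in (0 : ℝ)..b, h z * ∫ y in (b - z)..(c - z), U (c - z - y) * V y := by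
    rw [← intervalIntegral.integral_const_mul, ← intervalIntegral.integral_sub
      (intervalIntegrable_convolution_integrand hV le_rfl hb.le hc.le hbc.le (hh c))
      (hin.const_mul q)]
    refine intervalIntegral.integral_congr fun z hz => ?_
    rw [uIcc_of_le hb.le] at hz
    rw [← hsplit (c - z) (b - z) (by linarith [hz.2]) (by linarith [hz.2]) (by linarith)]
    ring
  rw [hL, hR, hw c hbc.le, ← hsplit c b hc hb.le hbc.le]
  ring

/-- For every `c > b`,
`w^{(q)}(c;0) - q∫_b^c 𝕎(c-y) w^{(q)}(y;0) dy
  = (1 - α W^{(q)}(0)) { 𝕎(c) + q∫₀^b 𝕎(c-y) 𝕎^{(q)}(y) dy }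
    - α∫₀^b W^{(q)′}(z) { 𝕎(c-z) + q∫₀^{b-z} 𝕎(c-z-y) 𝕎^{(q)}(y) dy } dz`. -/
theorem refracted_w_asymptotic_identity
    (γ σ : ℝ) (hσ : 0 ≤ σ) (ν : Measure ℝ) (hν : IsLevyMeasure ν)
    (hnd : NonDegenerate γ σ ν)
    (α : ℝ) (hα : AlphaAdmissible γ σ α ν)
    (b : ℝ) (hb : 0 < b) (q : ℝ) (hq : 0 ≤ q)
    (W W' Wαq Wα0 : ℝ → ℝ)
    (hW : IsScaleFunction (levyPsi γ σ ν) (levyPhi (levyPsi γ σ ν) q) q W)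
    (hW' : (∀ y : ℝ, 0 < y → HasDerivAt W (W' y) y) ∧ ContinuousOn W' (Set.Ioi 0))
    (hWαq : IsScaleFunction (fun l => levyPsi γ σ ν l - α * l)
      (levyPhi (fun l => levyPsi γ σ ν l - α * l) q) q Wαq)
    (hWα0 : IsScaleFunction (fun l => levyPsi γ σ ν l - α * l)
      (levyPhi (fun l => levyPsi γ σ ν l - α * l) 0) 0 Wα0) :
    ∀ c : ℝ, b < c →
      refractedW α b W W' Wαq c -
          q * ∫ y in b..c, Wα0 (c - y) * refractedW α b W W' Wαq y =
        (1 - α * W 0) * (Wα0 c + q * ∫ y in (0:ℝ)..b, Wα0 (c - y) * Wαq y) -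
          α * ∫ z in (0:ℝ)..b, W' z *
            (Wα0 (c - z) + q * ∫ y in (0:ℝ)..(b - z), Wα0 (c - z - y) * Wαq y) := by

  intro c hbc
  have hev := fun p => eventually_lt_levyPsi_sub hσ hν hα p
  have hevW : ∀ᶠ l in atTop, q < levyPsi γ σ ν l := by
    filter_upwards [hev q, eventually_ge_atTop 0] with l hl hl0
    nlinarith [mul_nonneg hα.1.le hl0]
  obtain ⟨L₁, h₁⟩ := hW.exists_laplace hevW
  obtain ⟨L₂, h₂⟩ := hWαq.exists_laplace (hev q)
  obtain ⟨L₃, h₃⟩ := hWα0.exists_laplace (hev 0)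
  have hW'lap := fun l (hl : max L₁ 0 < l) => laplace_deriv_of_monotoneOn (le_max_right L₁ 0)
    hW.2.1 hW.2.2.1 hW'.1 (fun l hl => (h₁ l ((le_max_left _ _).trans_lt hl)).2.1) hl
  have hW'int : ∀ X, IntegrableOn W' (Ioc 0 X) :=
    integrableOn_Ioc_of_laplace (hW'lap _ (lt_add_one _)).1
  have hVint : ∀ X, IntegrableOn Wαq (Ioc 0 X) :=
    integrableOn_Ioc_of_laplace (h₂ _ (lt_add_one _)).2.1
  have hVc := hWαq.2.1.mono Ioi_subset_Ici_self
  have hconv₁ := continuousOn_convolution_Ioi hWα0.2.1 hVint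
  have hconv₂ := continuousOn_convolution_Ioi hWαq.2.1 hW'int
  have hexp : ∀ (l r : ℝ) (f g : ℝ → ℝ), (fun x => Real.exp (-l * x) * (f x + r * g x)) =
      fun x => Real.exp (-l * x) * f x + r * (Real.exp (-l * x) * g x) := by
    intro l r f g
    ext x
    ring
  refine refractedW_sub_integral_eq hb hbc hWα0.2.1 hWαq.2.1 hW'int ?_ ?_
  · refine fun x hx => eqOn_Ioi_of_ae_eq
      (g := fun x => Wα0 x + q * ∫ y in (0 : ℝ)..x, Wα0 (x - y) * Wαq y)
      (ae_eq_of_laplace_eq (L := max L₂ L₃)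
        (fun l hl => (h₂ l ((le_max_left _ _).trans_lt hl)).2.1) ?_ ?_) hVc
      ((hWα0.2.1.mono Ioi_subset_Ici_self).add (hconv₁.const_smul q)) hx
    all_goals
      intro l hl
      obtain ⟨a₂, b₂, c₂⟩ := h₂ l ((le_max_left _ _).trans_lt hl)
      obtain ⟨a₃, b₃, c₃⟩ := h₃ l ((le_max_right _ _).trans_lt hl)
      obtain ⟨i, e⟩ := laplace_convolution b₂ b₃
      rw [hexp]
    · exact b₃.add (i.const_mul q)
    · rw [integral_add b₃ (i.const_mul q), integral_const_mul, e, c₂, c₃]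
      have d₂ := (sub_pos.2 a₂).ne'
      have d₃ := (sub_pos.2 a₃).ne'
      field_simp
      ring
  · refine fun x hx => eqOn_Ioi_of_ae_eq (f := fun x => (1 - α * W 0) * Wαq x)
      (g := fun x => W x + α * ∫ y in (0 : ℝ)..x, Wαq (x - y) * W' y)
      (ae_eq_of_laplace_eq (L := max (max L₁ 0) L₂) ?_ ?_ ?_) (hVc.const_smul (1 - α * W 0))
      ((hW.2.1.mono Ioi_subset_Ici_self).add (hconv₂.const_smul α)) hx
    all_goals
      intro l hl
      have hl' := (le_max_left _ _).trans_lt hl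
      obtain ⟨a₁, b₁, c₁⟩ := h₁ l ((le_max_left _ _).trans_lt hl')
      obtain ⟨a₂, b₂, c₂⟩ := h₂ l ((le_max_right _ _).trans_lt hl)
      obtain ⟨i', e'⟩ := hW'lap l hl'
      obtain ⟨i, e⟩ := laplace_convolution i' b₂
      try rw [hexp]
      try simp only [mul_left_comm (Real.exp _) (1 - α * W 0)]
    · exact b₂.const_mul _
    · exact b₁.add (i.const_mul α)
    · rw [integral_const_mul, integral_add b₁ (i.const_mul α), integral_const_mul, e, e', c₁, c₂]
      have d₁ := (sub_pos.2 a₁).ne'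
      have d₂ := (sub_pos.2 a₂).ne'
      field_simp
      ring
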